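/- Let X be a compact metric space, f : X → X continuous, C a chain component of f, δ > 0, g = f|_C, and m = m(C,δ) the gcd of the lengths of all δ-cycles of g. Then there exists N > 0 such that for any x, y ∈ C with x ∼_{C,δ} y and any n ≥ N, there is a δ-chain (x_i)_{i=0}^k of g with x_0 = x, x_k = y and k = mn. -/

import Mathlib

open Filter Metric Set Topology

section Defs

variable {X : Type*} [MetricSpace X]

/-- A δ-chain of `f` of length `k` (with `k ≥ 1`) within the set `C`, from `x` to `y`. -/
def ChainIn (f : X → X) (C : Set X) (δ : ℝ) (k : ℕ) (x y : X) : Prop :=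
  1 ≤ k ∧ ∃ c : ℕ → X, c 0 = x ∧ c k = y ∧ (∀ i ≤ k, c i ∈ C) ∧
    ∀ i < k, dist (f (c i)) (c (i + 1)) ≤ δ

/-- `x → y` : for every `δ > 0` there is a `δ`-chain of `f` from `x` to `y`. -/
def ChainReach (f : X → X) (x y : X) : Prop :=
  ∀ δ > 0, ∃ k, ChainIn f Set.univ δ k x y

/-- `x` is chain recurrent for `f`. -/
def ChainRecurrent (f : X → X) (x : X) : Prop := ChainReach f x x

/-- `C` is a chain component of `f`: an equivalence class of the relation `↔`
on the set of chain recurrent points. -/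
def IsChainComponent (f : X → X) (C : Set X) : Prop :=
  ∃ x, ChainRecurrent f x ∧
    C = {y | ChainRecurrent f y ∧ ChainReach f x y ∧ ChainReach f y x}

/-- The set of lengths of δ-cycles of `f` restricted to `C`. -/
def cycleLengths (f : X → X) (C : Set X) (δ : ℝ) : Set ℕ :=
  {k | ∃ x ∈ C, ChainIn f C δ k x x}

/-- The greatest common divisor of a set of natural numbers
(the greatest natural number dividing every element). -/
noncomputable def setGcd (S : Set ℕ) : ℕ := sSup {d | ∀ k ∈ S, d ∣ k}

/-- `x ∼_{C,δ} y` : there is a δ-chain of `f|_C` from `x` to `y` whose length is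
divisible by `m(C,δ)`, the gcd of the lengths of all δ-cycles of `f|_C`. -/
def SimCd (f : X → X) (C : Set X) (δ : ℝ) (x y : X) : Prop :=
  ∃ k, setGcd (cycleLengths f C δ) ∣ k ∧ ChainIn f C δ k x y

/-- `x ∼_C y` : `x ∼_{C,δ} y` for all `δ > 0`. -/
def SimC (f : X → X) (C : Set X) (x y : X) : Prop :=
  ∀ δ > 0, SimCd f C δ x y

/-- `𝒟(C,δ)` : the set of equivalence classes of `∼_{C,δ}`. -/
def DClassesd (f : X → X) (C : Set X) (δ : ℝ) : Set (Set X) :=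
  {D | ∃ x ∈ C, D = {y ∈ C | SimCd f C δ x y}}

/-- `𝒟(C)` : the set of equivalence classes of `∼_C`. -/
def DClasses (f : X → X) (C : Set X) : Set (Set X) :=
  {D | ∃ x ∈ C, D = {y ∈ C | SimC f C x y}}

/-- `W^s(C) = {x : lim_{i→∞} d(f^i(x), C) = 0}`. -/
def wStable (f : X → X) (C : Set X) : Set X :=
  {x | Tendsto (fun i => infDist (f^[i] x) C) atTop (nhds 0)}

/-- `V^s(D) = ⋂_{δ>0} {x ∈ W^s(C) : lim_{i→∞} d(f^i(x), f^i(D_δ)) = 0}`, where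
`D_δ` is the unique element of `𝒟(C,δ)` containing `D`. -/
def vStable (f : X → X) (C D : Set X) : Set X :=
  {x | x ∈ wStable f C ∧ ∀ δ > 0, ∀ Dd ∈ DClassesd f C δ, D ⊆ Dd →
    Tendsto (fun i => infDist (f^[i] x) (f^[i] '' Dd)) atTop (nhds 0)}

/-- The s-limit shadowing property. -/
def SLimitShadowing (f : X → X) : Prop :=
  ∀ ε > 0, ∃ δ > 0, ∀ x : ℕ → X,
    (∀ i, dist (f (x i)) (x (i + 1)) ≤ δ) →
    Tendsto (fun i => dist (f (x i)) (x (i + 1))) atTop (nhds 0) →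
    ∃ z : X, (∀ i, dist (f^[i] z) (x i) ≤ ε) ∧
      Tendsto (fun i => dist (f^[i] z) (x i)) atTop (nhds 0)

/-- The limit shadowing property. -/
def LimitShadowing (f : X → X) : Prop :=
  ∀ x : ℕ → X, Tendsto (fun i => dist (f (x i)) (x (i + 1))) atTop (nhds 0) →
    ∃ z : X, Tendsto (fun i => dist (f^[i] z) (x i)) atTop (nhds 0)

/-- The (plain) shadowing property. -/
def ShadowingProperty (f : X → X) : Prop :=
  ∀ ε > 0, ∃ δ > 0, ∀ x : ℕ → X, (∀ i, dist (f (x i)) (x (i + 1)) ≤ δ) →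
    ∃ z : X, ∀ i, dist (f^[i] z) (x i) ≤ ε

/-- A Furstenberg family: hereditary upward and proper. -/
def FurstenbergFamily (F : Set (Set ℕ)) : Prop :=
  (∀ A B : Set ℕ, A ∈ F → A ⊆ B → B ∈ F) ∧ F.Nonempty ∧ F ≠ Set.univ

/-- A full Furstenberg family. -/
def FullFamily (F : Set (Set ℕ)) : Prop :=
  ∀ A ∈ F, ∀ n : ℕ, {i ∈ A | n ≤ i} ∈ F

/-- A translation invariant Furstenberg family. -/
def TranslationInvariantFamily (F : Set (Set ℕ)) : Prop :=
  ∀ A ∈ F, ∀ n : ℕ, ((fun i => i + n) '' A ∈ F ∧ {i | i + n ∈ A} ∈ F)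

/-- `S_f(x₁,…,xₙ; r) = {i : min_{j<k} d(fⁱ(x_j), fⁱ(x_k)) > r}`. -/
def Sset (f : X → X) {n : ℕ} (x : Fin n → X) (r : ℝ) : Set ℕ :=
  {i | ∀ j k : Fin n, j < k → r < dist (f^[i] (x j)) (f^[i] (x k))}

/-- `T_f(x₁,…,xₙ; r) = {i : max_{j<k} d(fⁱ(x_j), fⁱ(x_k)) < r}`. -/
def Tset (f : X → X) {n : ℕ} (x : Fin n → X) (r : ℝ) : Set ℕ :=
  {i | ∀ j k : Fin n, j < k → dist (f^[i] (x j)) (f^[i] (x k)) < r}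

/-- `(x₁,…,xₙ)` is an `(ℱ,𝒢)`-δ-scrambled n-tuple for `f`. -/
def Scrambled (f : X → X) (F G : Set (Set ℕ)) (δ : ℝ) {n : ℕ} (x : Fin n → X) : Prop :=
  Sset f x δ ∈ F ∧ ∀ ε > 0, Tset f x ε ∈ G

/-- `Y` is dense `(ℱ,𝒢)`-n-δ-chaotic for `f`: the `(ℱ,𝒢)`-δ-scrambled n-tuples in `Yⁿ`
form a dense subset of `Yⁿ`. -/
def DenseChaotic (f : X → X) (F G : Set (Set ℕ)) (n : ℕ) (δ : ℝ) (Y : Set X) : Prop :=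
  {x : Fin n → X | ∀ j, x j ∈ Y} ⊆
    closure {x : Fin n → X | (∀ j, x j ∈ Y) ∧ Scrambled f F G δ x}

/-- `S` is a residual subset of the subspace `T`: it contains a countable intersection of
dense open subsets of `T`. -/
def ResidualIn {α : Type*} [TopologicalSpace α] (T S : Set α) : Prop :=
  ∃ U : ℕ → Set α, (∀ i, IsOpen (U i)) ∧ (∀ i, T ⊆ closure (U i ∩ T)) ∧
    (⋂ i, U i) ∩ T ⊆ S

/-- `Y` is generic `(ℱ,𝒢)`-n-δ-chaotic for `f`: the `(ℱ,𝒢)`-δ-scrambled n-tuples in `Yⁿ`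
form a residual subset of `Yⁿ`. -/
def GenericChaotic (f : X → X) (F G : Set (Set ℕ)) (n : ℕ) (δ : ℝ) (Y : Set X) : Prop :=
  ResidualIn {x : Fin n → X | ∀ j, x j ∈ Y}
    {x : Fin n → X | (∀ j, x j ∈ Y) ∧ Scrambled f F G δ x}

/-- A Furstenberg family `F` is compatible with `(Z, g)`. -/
def CompatibleFamily {Z : Type*} [TopologicalSpace Z] (F : Set (Set ℕ)) (g : Z → Z) : Prop :=
  ∀ U : Set Z, IsOpen U → IsGδ {z | {i | g^[i] z ∈ U} ∈ F}

end Defs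

section ChainLemmas

variable {X : Type*} [MetricSpace X] {f : X → X} {C : Set X} {δ ε η : ℝ} {k l : ℕ} {x y z : X}

lemma ChainIn.mono (h : ChainIn f C δ k x y) (hδ : δ ≤ ε) : ChainIn f C ε k x y := by
  obtain ⟨hk, c, h0, h1, hc, hd⟩ := h
  exact ⟨hk, c, h0, h1, hc, fun i hi => (hd i hi).trans hδ⟩

lemma ChainIn.single (hx : x ∈ C) (hy : y ∈ C) (h : dist (f x) y ≤ δ) : ChainIn f C δ 1 x y := by
  refine ⟨le_rfl, fun i => if i = 0 then x else y, by simp, by simp, fun i _ => ?_, fun i hi => ?_⟩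
  · dsimp only
    split_ifs <;> assumption
  · obtain rfl : i = 0 := by omega
    simpa using h

lemma ChainIn.trans (h₁ : ChainIn f C δ k x y) (h₂ : ChainIn f C δ l y z) :
    ChainIn f C δ (k + l) x z := by
  obtain ⟨hk, c, hc0, hck, hcC, hcd⟩ := h₁
  obtain ⟨hl, e, he0, hel, heC, hed⟩ := h₂
  refine ⟨by omega, fun i => if i < k then c i else e (i - k), ?_, ?_, fun i hi => ?_,
    fun i hi => ?_⟩
  · simpa [show 0 < k by omega] using hc0
  · simpa using hel
  · dsimp only
    split_ifs with h
    · exact hcC i h.le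
    · exact heC _ (by omega)
  · dsimp only
    rcases lt_trichotomy (i + 1) k with h | h | h
    · rw [if_pos (by omega), if_pos h]
      exact hcd i (by omega)
    · rw [if_pos (by omega), if_neg (by omega), h, Nat.sub_self, he0, ← hck, ← h]
      exact hcd i (by omega)
    · rw [if_neg (by omega), if_neg (by omega), show i + 1 - k = i - k + 1 by omega]
      exact hed _ (by omega)

/-- The last point of a chain may be perturbed. -/
lemma ChainIn.replace_right (h : ChainIn f C δ k x y) (hz : z ∈ C) (hyz : dist y z ≤ η) :
    ChainIn f C (δ + η) k x z := by
  obtain ⟨hk, c, h0, h1, hc, hd⟩ := h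
  have hη : 0 ≤ η := dist_nonneg.trans hyz
  refine ⟨hk, Function.update c k z, ?_, by simp, fun i hi => ?_, fun i hi => ?_⟩
  · rwa [Function.update_of_ne (by omega)]
  · rcases eq_or_ne i k with rfl | h
    · simpa using hz
    · rw [Function.update_of_ne h]
      exact hc i hi
  · rw [Function.update_of_ne hi.ne]
    rcases eq_or_ne (i + 1) k with h | h
    · have := hd i hi
      rw [h, h1] at this
      rw [h, Function.update_self]
      exact (dist_triangle _ y _).trans (add_le_add this hyz)
    · rw [Function.update_of_ne h]
      exact (hd i hi).trans (by linarith)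

/-- The first point of a chain may be perturbed. -/
lemma ChainIn.replace_left (h : ChainIn f C δ k x y) (hz : z ∈ C) (hxz : dist (f z) (f x) ≤ η) :
    ChainIn f C (δ + η) k z y := by
  obtain ⟨hk, c, h0, h1, hc, hd⟩ := h
  have hη : 0 ≤ η := dist_nonneg.trans hxz
  refine ⟨hk, Function.update c 0 z, by simp, ?_, fun i hi => ?_, fun i hi => ?_⟩
  · rwa [Function.update_of_ne (by omega)]
  · rcases eq_or_ne i 0 with rfl | h
    · simpa using hz
    · rw [Function.update_of_ne h]
      exact hc i hi
  · rw [Function.update_of_ne (by omega : i + 1 ≠ 0)]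
    rcases eq_or_ne i 0 with rfl | h
    · have := hd 0 hi
      rw [h0] at this
      rw [Function.update_self]
      linarith [dist_triangle (f z) (f x) (c (0 + 1))]
    · rw [Function.update_of_ne h]
      exact (hd i hi).trans (by linarith)

lemma ChainIn.exists_first_step (h : ChainIn f C δ k x y) : ∃ w ∈ C, dist (f x) w ≤ δ := by
  obtain ⟨hk, c, rfl, -, hc, hd⟩ := h
  exact ⟨c 1, hc 1 hk, hd 0 hk⟩

lemma ChainReach.trans (h₁ : ChainReach f x y) (h₂ : ChainReach f y z) : ChainReach f x z := by
  intro δ hδ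
  obtain ⟨k, hk⟩ := h₁ δ hδ
  obtain ⟨l, hl⟩ := h₂ δ hδ
  exact ⟨k + l, hk.trans hl⟩

lemma IsChainComponent.nonempty (hC : IsChainComponent f C) : C.Nonempty := by
  obtain ⟨x, hx, rfl⟩ := hC
  exact ⟨x, hx, hx, hx⟩

lemma IsChainComponent.chainReach (hC : IsChainComponent f C) (hx : x ∈ C) (hy : y ∈ C) :
    ChainReach f x y := by
  obtain ⟨p, -, rfl⟩ := hC
  exact hx.2.2.trans hy.2.1

lemma IsChainComponent.mem_of_chainReach (hC : IsChainComponent f C) (hx : x ∈ C)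
    (hxy : ChainReach f x y) (hyx : ChainReach f y x) : y ∈ C := by
  obtain ⟨p, -, rfl⟩ := hC
  exact ⟨hyx.trans hxy, hx.2.1.trans hxy, hyx.trans hx.2.2⟩

/-- Points lying on sufficiently fine cycles through a point of a chain component are close to
the chain component. -/
lemma IsChainComponent.exists_cycle_subset_thickening [CompactSpace X] (hf : Continuous f)
    (hC : IsChainComponent f C) (hx : x ∈ C) (hη : 0 < η) :
    ∃ ε > 0, ∀ z k l, ChainIn f univ ε k x z → ChainIn f univ ε l z x →
      ∃ w ∈ C, dist z w < η := by
  by_contra! H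
  choose z k l hk hl hz using fun n : ℕ => H (1 / ((n : ℝ) + 1)) (by positivity)
  obtain ⟨a, φ, hφ, ha⟩ := CompactSpace.tendsto_subseq z
  have hlim : Tendsto (fun n => 1 / ((φ n : ℝ) + 1)) atTop (𝓝 0) :=
    tendsto_one_div_add_atTop_nhds_zero_nat.comp hφ.tendsto_atTop
  have hfa : Tendsto (fun n => f (z (φ n))) atTop (𝓝 (f a)) := (hf.tendsto a).comp ha
  have haC : a ∈ C := by
    refine hC.mem_of_chainReach hx (fun δ hδ => ?_) (fun δ hδ => ?_)
    · obtain ⟨n, hn₁, hn₂⟩ := ((hlim.eventually_lt_const (half_pos hδ)).and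
        (Metric.tendsto_nhds.1 ha _ (half_pos hδ))).exists
      exact ⟨_, ((hk (φ n)).replace_right (mem_univ a) hn₂.le).mono (by linarith)⟩
    · obtain ⟨n, hn₁, hn₂⟩ := ((hlim.eventually_lt_const (half_pos hδ)).and
        (Metric.tendsto_nhds.1 hfa _ (half_pos hδ))).exists
      rw [dist_comm] at hn₂
      exact ⟨_, ((hl (φ n)).replace_left (mem_univ a) hn₂.le).mono (by linarith)⟩
  obtain ⟨n, hn⟩ := (Metric.tendsto_nhds.1 ha η hη).exists
  exact (hz (φ n) a haC).not_gt hn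

/-- The restriction of `f` to a chain component is chain transitive. -/
lemma IsChainComponent.exists_chainIn [CompactSpace X] (hf : Continuous f)
    (hC : IsChainComponent f C) (hx : x ∈ C) (hy : y ∈ C) (hδ : 0 < δ) :
    ∃ k, ChainIn f C δ k x y := by
  obtain ⟨η, hη, hfη⟩ := Metric.uniformContinuous_iff.1
    (CompactSpace.uniformContinuous_of_continuous hf) (δ / 3) (by positivity)
  obtain ⟨ε, hε, hεC⟩ := hC.exists_cycle_subset_thickening hf hx
    (lt_min hη (by positivity : 0 < δ / 3))
  obtain ⟨k, hk, c, h0, h1, -, hd⟩ := hC.chainReach hx hy (min ε (δ / 3)) (by positivity)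
  obtain ⟨l, hl⟩ := hC.chainReach hy hx ε hε
  have key : ∀ i, ∃ w, i ≤ k → w ∈ C ∧ dist (c i) w < min η (δ / 3) ∧
      (i = 0 → w = x) ∧ (i = k → w = y) := by
    intro i
    by_cases hik : i ≤ k
    swap
    · exact ⟨x, fun h => absurd h hik⟩
    rcases eq_or_ne i 0 with rfl | hi0
    · exact ⟨x, fun _ => ⟨hx, by rw [h0, dist_self]; positivity, fun _ => rfl, by omega⟩⟩
    rcases eq_or_ne i k with rfl | hik'
    · exact ⟨y, fun _ => ⟨hy, by rw [h1, dist_self]; positivity, by omega, fun _ => rfl⟩⟩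
    have hpre : ChainIn f univ ε i x (c i) :=
      ⟨by omega, c, h0, rfl, fun _ _ => mem_univ _,
        fun j hj => (hd j (by omega)).trans (min_le_left _ _)⟩
    have hsuf : ChainIn f univ ε (k - i) (c i) y := by
      refine ⟨by omega, fun j => c (i + j), rfl, ?_, fun _ _ => mem_univ _,
        fun j hj => (hd (i + j) (by omega)).trans (min_le_left _ _)⟩
      dsimp only
      rw [Nat.add_sub_cancel' hik, h1]
    obtain ⟨w, hw, hdw⟩ := hεC _ _ _ hpre (hsuf.trans hl)
    exact ⟨w, fun _ => ⟨hw, hdw, fun h => absurd h hi0, fun h => absurd h hik'⟩⟩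
  choose w hw using key
  refine ⟨k, hk, w, (hw 0 (by omega)).2.2.1 rfl, (hw k le_rfl).2.2.2 rfl,
    fun i hi => (hw i hi).1, fun i hi => ?_⟩
  have e1 := hfη ((hw i hi.le).2.1.trans_le (min_le_left _ _))
  have e2 := (hd i hi).trans (min_le_right _ _)
  have e3 := (hw (i + 1) hi).2.1.trans_le (min_le_right _ _)
  rw [dist_comm] at e1
  linarith [dist_triangle4 (f (w i)) (f (c i)) (c (i + 1)) (w (i + 1))]

lemma setGcd_eq_nat_setGcd {S : Set ℕ} (hk : k ∈ S) (hk0 : k ≠ 0) : setGcd S = Nat.setGcd S := by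
  refine IsGreatest.csSup_eq ⟨fun _ => Nat.setGcd_dvd_of_mem, fun d hd => ?_⟩
  exact Nat.le_of_dvd (Nat.pos_of_dvd_of_pos (Nat.setGcd_dvd_of_mem hk) (Nat.pos_of_ne_zero hk0))
    (Nat.dvd_setGcd_iff.2 hd)

lemma setGcd_cycleLengths_dvd (hx : x ∈ C) (h : ChainIn f C δ k x x) :
    setGcd (cycleLengths f C δ) ∣ k := by
  have hk : k ∈ cycleLengths f C δ := ⟨x, hx, h⟩
  rw [setGcd_eq_nat_setGcd hk (Nat.one_le_iff_ne_zero.1 h.1)]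
  exact Nat.setGcd_dvd_of_mem hk

/-- All sufficiently large multiples of the gcd of the cycle lengths are lengths of cycles through
a given point. -/
lemma exists_cycle_of_ge (hC : ∀ x ∈ C, ∀ y ∈ C, ∃ k, ChainIn f C δ k x y) (hx : x ∈ C) :
    ∃ N, ∀ n ≥ N, setGcd (cycleLengths f C δ) ∣ n → ChainIn f C δ n x x := by
  obtain ⟨N, hN⟩ := Nat.exists_mem_closure_of_ge {k | ChainIn f C δ k x x}
  have hdvd : Nat.setGcd {k | ChainIn f C δ k x x} ∣ setGcd (cycleLengths f C δ) := by
    obtain ⟨k, hk⟩ := hC x hx x hx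
    have hkS : k ∈ cycleLengths f C δ := ⟨x, hx, hk⟩
    rw [setGcd_eq_nat_setGcd hkS (Nat.one_le_iff_ne_zero.1 hk.1), Nat.dvd_setGcd_iff]
    rintro l ⟨y, hy, hl⟩
    obtain ⟨a, ha⟩ := hC x hx y hy
    obtain ⟨b, hb⟩ := hC y hy x hx
    have h₁ := Nat.setGcd_dvd_of_mem (s := {k | ChainIn f C δ k x x}) (ha.trans hb)
    have h₂ := Nat.setGcd_dvd_of_mem (s := {k | ChainIn f C δ k x x}) (ha.trans (hl.trans hb))
    rw [show a + (l + b) = l + (a + b) by ring] at h₂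
    exact (Nat.dvd_add_left h₁).1 h₂
  refine ⟨N + 1, fun n hn hmn => ?_⟩
  have hmem := hN n (by omega) (hdvd.trans hmn)
  have : ∀ n ∈ AddSubmonoid.closure {k | ChainIn f C δ k x x}, n = 0 ∨ ChainIn f C δ n x x := by
    intro n hn
    induction hn using AddSubmonoid.closure_induction with
    | mem k hk => exact Or.inr hk
    | zero => exact Or.inl rfl
    | add a b _ _ ha hb =>
      rcases ha with rfl | ha
      · simpa using hb
      · rcases hb with rfl | hb
        · exact Or.inr ha
        · exact Or.inr (ha.trans hb)
  exact (this n hmem).resolve_left (by omega)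

/-- Any two points of `C` are joined by chains of uniformly bounded length to and from a
base point. -/
lemma exists_bounded_chains [CompactSpace X] (hδ : 0 < δ)
    (hC : ∀ x ∈ C, ∀ y ∈ C, ∃ k, ChainIn f C (δ / 2) k x y) (hx : x ∈ C) :
    ∃ A, ∀ y ∈ C, (∃ k ≤ A, ChainIn f C δ k x y) ∧ ∃ k ≤ A, ChainIn f C δ k y x := by
  have htb : TotallyBounded C := isCompact_univ.totallyBounded.subset (subset_univ C)
  obtain ⟨t, htC, htfin, hcov⟩ := Metric.finite_approx_of_totallyBounded htb (δ / 2) (half_pos hδ)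
  have hfar : ∀ q, ∃ a b, q ∈ t → ChainIn f C (δ / 2) a x q ∧ ChainIn f C (δ / 2) b q x := by
    intro q
    by_cases hq : q ∈ t
    · obtain ⟨a, ha⟩ := hC x hx q (htC hq)
      obtain ⟨b, hb⟩ := hC q (htC hq) x hx
      exact ⟨a, b, fun _ => ⟨ha, hb⟩⟩
    · exact ⟨0, 0, fun h => absurd h hq⟩
  choose a b hab using hfar
  obtain ⟨A, hA⟩ := (htfin.image a).bddAbove
  obtain ⟨B, hB⟩ := (htfin.image b).bddAbove
  refine ⟨A + (1 + B), fun y hy => ⟨?_, ?_⟩⟩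
  · obtain ⟨q, hq, hyq⟩ := mem_iUnion₂.1 (hcov hy)
    rw [mem_ball, dist_comm] at hyq
    exact ⟨a q, (hA (mem_image_of_mem a hq)).trans (by omega),
      ((hab q hq).1.replace_right hy hyq.le).mono (by linarith)⟩
  · obtain ⟨k, hk⟩ := hC y hy y hy
    obtain ⟨w, hw, hyw⟩ := hk.exists_first_step
    obtain ⟨q, hq, hwq⟩ := mem_iUnion₂.1 (hcov hw)
    rw [mem_ball] at hwq
    refine ⟨1 + b q, ?_, ?_⟩
    · have := hB (mem_image_of_mem b hq)
      omega
    · exact (ChainIn.single hy (htC hq) (by linarith [dist_triangle (f y) w q])).trans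
        ((hab q hq).2.mono (by linarith))

end ChainLemmas

/-- property (P4): there is `N > 0` such that any two `∼_{C,δ}`-equivalent
points of `C` are joined by a δ-chain of `f|_C` of length `m(C,δ)·n` for every `n ≥ N`. -/
theorem exists_uniform_chain_length
    {X : Type*} [MetricSpace X] [CompactSpace X] (f : X → X) (hf : Continuous f)
    (C : Set X) (hC : IsChainComponent f C) (δ : ℝ) (hδ : 0 < δ) :
    ∃ N : ℕ, 0 < N ∧ ∀ x ∈ C, ∀ y ∈ C, SimCd f C δ x y → ∀ n : ℕ, N ≤ n →
      ChainIn f C δ (setGcd (cycleLengths f C δ) * n) x y := by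
  have hchain : ∀ ε > 0, ∀ x ∈ C, ∀ y ∈ C, ∃ k, ChainIn f C ε k x y :=
    fun ε hε x hx y hy => hC.exists_chainIn hf hx hy hε
  obtain ⟨p, hp⟩ := hC.nonempty
  obtain ⟨N, hN⟩ := exists_cycle_of_ge (hchain δ hδ) hp
  obtain ⟨A, hA⟩ := exists_bounded_chains hδ (hchain (δ / 2) (half_pos hδ)) hp
  have hm : 0 < setGcd (cycleLengths f C δ) := by
    obtain ⟨k, hk⟩ := hchain δ hδ p hp p hp
    exact Nat.pos_of_dvd_of_pos (setGcd_cycleLengths_dvd hp hk) hk.1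
  refine ⟨N + A + A + 1, by omega, ?_⟩
  rintro x hx y hy ⟨k, hmk, hk⟩ n hn
  obtain ⟨a, haA, ha⟩ := (hA x hx).2
  obtain ⟨b, hbA, hb⟩ := (hA y hy).1
  obtain ⟨c, -, hc⟩ := (hA y hy).2
  obtain ⟨e, -, he⟩ := (hA x hx).1
  set m := setGcd (cycleLengths f C δ)
  have h₁ : m ∣ a + e := setGcd_cycleLengths_dvd hx (ha.trans he)
  have h₂ : m ∣ b + c := setGcd_cycleLengths_dvd hp (hb.trans hc)
  have h₃ : m ∣ k + (c + e) := setGcd_cycleLengths_dvd hx (hk.trans (hc.trans he))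
  have hab : m ∣ a + b := by
    have h₄ : m ∣ c + e := (Nat.dvd_add_right hmk).1 h₃
    refine (Nat.dvd_add_left h₄).1 ?_
    have h₅ := dvd_add h₁ h₂
    rwa [show a + e + (b + c) = a + b + (c + e) by ring] at h₅
  have hmn : n ≤ m * n := Nat.le_mul_of_pos_left n hm
  have hloop : ChainIn f C δ (m * n - (a + b)) p p :=
    hN _ (by omega) (Nat.dvd_sub (dvd_mul_right m n) hab)
  convert ha.trans (hloop.trans hb) using 1
  omega
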